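/- For α ≥ 0, the probability that G(n, α/n) is connected equals (1 - e^(-α))^n · e^(O(log n)) as n → ∞; equivalently, there exist constants C and n_0 depending on α such that for n ≥ n_0, n^(-C) ≤ P(G(n,α/n) connected) / (1 - e^(-α))^n ≤ n^C. -/

import Mathlib

open MeasureTheory

noncomputable def bern (p : ℝ) : Measure Bool :=
  ENNReal.ofReal p • Measure.dirac true + ENNReal.ofReal (1 - p) • Measure.dirac false

noncomputable def erMeasure (n : ℕ) (p : ℝ) :
    Measure ({e : Sym2 (Fin n) // ¬ e.IsDiag} → Bool) :=
  Measure.pi fun _ => bern p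

def erGraph (n : ℕ) (ω : {e : Sym2 (Fin n) // ¬ e.IsDiag} → Bool) : SimpleGraph (Fin n) :=
  SimpleGraph.fromEdgeSet {e : Sym2 (Fin n) | ∃ h : ¬ e.IsDiag, ω ⟨e, h⟩ = true}

open ProbabilityTheory

lemma isProbabilityMeasure_bern {p : ℝ} (h0 : 0 ≤ p) (h1 : p ≤ 1) :
    IsProbabilityMeasure (bern p) := by
  constructor
  simp only [bern, Measure.coe_add, Measure.coe_smul, Pi.add_apply, Pi.smul_apply, measure_univ,
    smul_eq_mul, mul_one]
  rw [← ENNReal.ofReal_add h0 (by linarith)]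
  simp

lemma isProbabilityMeasure_erMeasure (n : ℕ) {p : ℝ} (h0 : 0 ≤ p) (h1 : p ≤ 1) :
    IsProbabilityMeasure (erMeasure n p) := by
  have := isProbabilityMeasure_bern h0 h1
  unfold erMeasure
  infer_instance

/-- Events determined by disjoint sets of edges are independent. -/
lemma erMeasure_real_inter (n : ℕ) {p : ℝ} (h0 : 0 ≤ p) (h1 : p ≤ 1)
    (S T : Finset {e : Sym2 (Fin n) // ¬ e.IsDiag}) (hST : Disjoint S T)
    (E F : Set ({e : Sym2 (Fin n) // ¬ e.IsDiag} → Bool))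
    (hE : ∀ ω ω', (∀ e ∈ S, ω e = ω' e) → ω ∈ E → ω' ∈ E)
    (hF : ∀ ω ω', (∀ e ∈ T, ω e = ω' e) → ω ∈ F → ω' ∈ F) :
    (erMeasure n p).real (E ∩ F) = (erMeasure n p).real E * (erMeasure n p).real F := by
  have := isProbabilityMeasure_bern h0 h1
  have hind : iIndepFun (fun (i : {e : Sym2 (Fin n) // ¬ e.IsDiag})
      (ω : {e : Sym2 (Fin n) // ¬ e.IsDiag} → Bool) ↦ ω i) (erMeasure n p) :=
    iIndepFun_pi (X := fun _ b ↦ b) (fun _ ↦ aemeasurable_id)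
  have hpair := hind.indepFun_finset S T hST (fun i ↦ measurable_pi_apply i)
  have key : ∀ (R : Finset {e : Sym2 (Fin n) // ¬ e.IsDiag})
      (D : Set ({e : Sym2 (Fin n) // ¬ e.IsDiag} → Bool)),
      (∀ ω ω', (∀ e ∈ R, ω e = ω' e) → ω ∈ D → ω' ∈ D) →
      D = (fun ω (i : R) ↦ ω i) ⁻¹' (Set.image (fun ω (i : R) ↦ ω i) D) := by
    intro R D hD
    refine Set.Subset.antisymm (Set.subset_preimage_image _ _) ?_
    rintro ω ⟨ω', hω', h⟩
    exact hD ω' ω (fun e he ↦ congrFun h ⟨e, he⟩) hω'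
  rw [key S E hE, key T F hF]
  simp only [Measure.real, ← ENNReal.toReal_mul]
  rw [hpair.measure_inter_preimage_eq_mul _ _ (Set.toFinite _).measurableSet
    (Set.toFinite _).measurableSet]

lemma erGraph_adj {n : ℕ} {ω : {e : Sym2 (Fin n) // ¬ e.IsDiag} → Bool} {a b : Fin n}
    (h : a ≠ b) : (erGraph n ω).Adj a b ↔ ω ⟨s(a, b), by simpa using h⟩ = true := by
  simp [erGraph, h]

lemma erMeasure_real_adj_iff (n : ℕ) {p : ℝ} (h0 : 0 ≤ p) (h1 : p ≤ 1) {a b : Fin n}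
    (h : a ≠ b) (P : Prop) [Decidable P] :
    (erMeasure n p).real {ω | (erGraph n ω).Adj a b ↔ P} = if P then p else 1 - p := by
  have := isProbabilityMeasure_bern h0 h1
  have hmp := measurePreserving_eval (fun _ : {e : Sym2 (Fin n) // ¬ e.IsDiag} ↦ bern p)
    ⟨s(a, b), by simpa using h⟩
  have hset : {ω | (erGraph n ω).Adj a b ↔ P} =
      Function.eval (β := fun _ : {e : Sym2 (Fin n) // ¬ e.IsDiag} ↦ Bool)
        ⟨s(a, b), by simpa using h⟩ ⁻¹' {decide P} := by
    ext ω
    by_cases hP : P <;> simp [erGraph_adj h, hP]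
  have hm : (erMeasure n p) {ω | (erGraph n ω).Adj a b ↔ P} = bern p {decide P} := by
    rw [hset]
    exact hmp.measure_preimage (Set.toFinite _).measurableSet.nullMeasurableSet
  rw [Measure.real, hm]
  by_cases hP : P <;> simp [hP, bern, h0, h1]

/-- The law of the neighbourhood of `a` inside `U`. -/
lemma erMeasure_real_neighbors (n : ℕ) {p : ℝ} (h0 : 0 ≤ p) (h1 : p ≤ 1) (a : Fin n)
    (S U : Finset (Fin n)) (ha : a ∉ U) :
    (erMeasure n p).real {ω | ∀ u ∈ U, ((erGraph n ω).Adj a u ↔ u ∈ S)} =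
      ∏ u ∈ U, if u ∈ S then p else 1 - p := by
  have := isProbabilityMeasure_erMeasure n h0 h1
  induction U using Finset.induction_on with
  | empty => simp
  | insert u U hu ih =>
    have hau : a ≠ u := fun h ↦ ha (by simp [h])
    have haU : a ∉ U := fun h ↦ ha (by simp [h])
    rw [Finset.prod_insert hu, ← ih haU, ← erMeasure_real_adj_iff n h0 h1 hau (u ∈ S)]
    rw [← erMeasure_real_inter n h0 h1 {e | e.1 = s(a, u)} {e | ∃ v ∈ U, e.1 = s(a, v)}]
    · congr 1
      ext ω
      simp
    · rw [Finset.disjoint_left]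
      simp only [Finset.mem_filter, Finset.mem_univ, true_and, not_exists, not_and]
      intro e he v hv h
      rw [he, Sym2.congr_right] at h
      exact hu (h ▸ hv)
    · intro ω ω' h hω
      simp only [Set.mem_ofPred_eq, erGraph_adj hau] at hω ⊢
      rwa [← h _ (by simp)]
    · intro ω ω' h hω v hv
      have hav : a ≠ v := fun h ↦ haU (h ▸ hv)
      have := hω v hv
      rw [erGraph_adj hav] at this ⊢
      rwa [← h _ (by simpa using ⟨v, hv, Or.inl rfl⟩)]

/-- Every vertex of `U` is joined to `A` by a path inside `A ∪ U`, expressed through cuts. -/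
def ReachesWithin {V : Type*} (G : SimpleGraph V) (A U : Finset V) : Prop :=
  ∀ T ⊆ U, T.Nonempty → ∃ t ∈ T, ∃ s, (s ∈ A ∨ s ∈ U) ∧ s ∉ T ∧ G.Adj s t

lemma reachesWithin_empty_right {V : Type*} (G : SimpleGraph V) (A : Finset V) :
    ReachesWithin G A ∅ := by
  intro T hT hne
  simp [Finset.subset_empty.1 hT] at hne

lemma not_reachesWithin_empty_left {V : Type*} (G : SimpleGraph V) {U : Finset V}
    (hU : U.Nonempty) : ¬ ReachesWithin G ∅ U := by
  intro h
  obtain ⟨t, -, s, hs, hs', -⟩ := h U subset_rfl hU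
  simp_all

lemma connected_iff_reachesWithin {V : Type*} [Fintype V] [DecidableEq V] (G : SimpleGraph V)
    (r : V) : G.Connected ↔ ReachesWithin G {r} (Finset.univ.erase r) := by
  classical
  constructor
  · rintro h T hT ⟨t, ht⟩
    obtain ⟨w⟩ := h.preconnected t r
    obtain ⟨d, -, hd, hd'⟩ := w.exists_boundary_dart T ht
      (fun hr ↦ by simpa using hT hr)
    refine ⟨d.fst, hd, d.snd, ?_, hd', d.adj.symm⟩
    simp [em]
  · intro h
    have hr : ∀ v, G.Reachable r v := by
      by_contra! ⟨v, hv⟩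
      obtain ⟨t, ht, s, -, hs, hst⟩ := h {v | ¬ G.Reachable r v}
        (fun x hx ↦ by
          simp only [Finset.mem_filter, Finset.mem_univ, true_and] at hx
          simp only [Finset.mem_erase, Finset.mem_univ, and_true]
          rintro rfl
          exact hx (SimpleGraph.Reachable.refl x))
        ⟨v, by simpa using hv⟩
      simp only [Finset.mem_filter, Finset.mem_univ, true_and, not_not] at ht hs
      exact ht (hs.trans hst.reachable)
    have : Nonempty V := ⟨r⟩
    exact ⟨fun u v ↦ (hr u).symm.trans (hr v)⟩

/-- One step of exploration: processing the active vertex `a`, whose neighbourhood in `U` is `S`. -/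
lemma reachesWithin_insert_iff {V : Type*} [DecidableEq V] (G : SimpleGraph V) (a : V)
    (A U S : Finset V) (hU : a ∉ U) (hSU : S ⊆ U) (hS : ∀ u ∈ U, (G.Adj a u ↔ u ∈ S)) :
    ReachesWithin G (insert a A) U ↔ ReachesWithin G (A ∪ S) (U \ S) := by
  constructor
  · intro h T hT hne
    obtain ⟨t, ht, s, hs, hsT, hst⟩ := h T (hT.trans Finset.sdiff_subset) hne
    refine ⟨t, ht, s, ?_, hsT, hst⟩
    have htU := Finset.mem_sdiff.1 (hT ht)
    have hsa : s ≠ a := by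
      rintro rfl
      exact htU.2 ((hS t htU.1).1 hst)
    simp only [Finset.mem_insert, hsa, false_or] at hs
    simp only [Finset.mem_union, Finset.mem_sdiff]
    tauto
  · intro h T hT hne
    by_cases hTS : ∃ t ∈ T, t ∈ S
    · obtain ⟨t, ht, htS⟩ := hTS
      exact ⟨t, ht, a, by simp, fun haT ↦ hU (hT haT), (hS t (hT ht)).2 htS⟩
    · push Not at hTS
      obtain ⟨t, ht, s, hs, hsT, hst⟩ := h T
        (fun t ht ↦ Finset.mem_sdiff.2 ⟨hT ht, hTS t ht⟩) hne
      refine ⟨t, ht, s, ?_, hsT, hst⟩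
      simp only [Finset.mem_union, Finset.mem_sdiff] at hs
      have := @hSU s
      simp only [Finset.mem_insert]
      tauto

lemma erMeasure_real_reachesWithin_insert (n : ℕ) {p : ℝ} (h0 : 0 ≤ p) (h1 : p ≤ 1)
    (a : Fin n) (A U : Finset (Fin n)) (haA : a ∉ A) (haU : a ∉ U) :
    (erMeasure n p).real {ω | ReachesWithin (erGraph n ω) (insert a A) U} =
      ∑ S ∈ U.powerset, p ^ S.card * (1 - p) ^ (U.card - S.card) *
        (erMeasure n p).real {ω | ReachesWithin (erGraph n ω) (A ∪ S) (U \ S)} := by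
  classical
  have := isProbabilityMeasure_erMeasure n h0 h1
  have hsplit : {ω | ReachesWithin (erGraph n ω) (insert a A) U} =
      ⋃ S ∈ U.powerset, {ω | ∀ u ∈ U, ((erGraph n ω).Adj a u ↔ u ∈ S)} ∩
        {ω | ReachesWithin (erGraph n ω) (A ∪ S) (U \ S)} := by
    ext ω
    simp only [Set.mem_iUnion, Set.mem_inter_iff, Set.mem_ofPred_eq, Finset.mem_powerset]
    constructor
    · intro h
      have hS : ∀ u ∈ U, ((erGraph n ω).Adj a u ↔ u ∈ U.filter ((erGraph n ω).Adj a)) := by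
        intro u hu
        simp [hu]
      exact ⟨_, Finset.filter_subset _ _, hS,
        (reachesWithin_insert_iff _ a A U _ haU (Finset.filter_subset _ _) hS).1 h⟩
    · rintro ⟨S, hSU, hS, h⟩
      exact (reachesWithin_insert_iff _ a A U S haU hSU hS).2 h
  rw [hsplit, measureReal_biUnion_finset]
  · refine Finset.sum_congr rfl fun S hS ↦ ?_
    rw [Finset.mem_powerset] at hS
    rw [erMeasure_real_inter n h0 h1 {e | a ∈ e.1} {e | ∀ v ∈ e.1, v ∈ A ∪ U},
      erMeasure_real_neighbors n h0 h1 a S U haU, Finset.prod_ite, Finset.prod_const,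
      Finset.prod_const, Finset.filter_mem_eq_inter, Finset.inter_eq_right.2 hS,
      Finset.filter_notMem_eq_sdiff, Finset.card_sdiff_of_subset hS]
    · rw [Finset.disjoint_left]
      simp only [Finset.mem_filter, Finset.mem_univ, true_and]
      intro e he h
      have := h a he
      simp_all
    · intro ω ω' h hω v hv
      have hav : a ≠ v := fun h ↦ haU (h ▸ hv)
      have := hω v hv
      rw [erGraph_adj hav] at this ⊢
      rwa [← h _ (by simp)]
    · intro ω ω' h hω T hT hne
      obtain ⟨t, ht, s, hs, hsT, hst⟩ := hω T hT hne
      refine ⟨t, ht, s, hs, hsT, ?_⟩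
      have hne' := hst.ne
      rw [erGraph_adj hne'] at hst ⊢
      rwa [← h _ ?_]
      have htU := Finset.mem_sdiff.1 (hT ht)
      have := @hS s
      simp only [Finset.mem_union, Finset.mem_sdiff] at hs
      simp only [Finset.mem_filter, Finset.mem_univ, true_and, Sym2.mem_iff, Finset.mem_union]
      rintro v (rfl | rfl) <;> tauto
  · intro S hS S' hS' hne
    rw [Function.onFun, Set.disjoint_left]
    rintro ω ⟨h, -⟩ ⟨h', -⟩
    refine hne (Finset.ext fun u ↦ ?_)
    simp only [Finset.coe_powerset, Set.mem_preimage, Set.mem_powerset_iff,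
      Finset.coe_subset] at hS hS'
    constructor
    · intro hu
      exact (h' u (hS hu)).1 ((h u (hS hu)).2 hu)
    · intro hu
      exact (h u (hS' hu)).1 ((h' u (hS' hu)).2 hu)
  · intro S _
    exact (Set.toFinite _).measurableSet

lemma sum_powerset_card_mul_pow {ι : Type*} (U : Finset ι) (a b : ℝ) :
    (a + b) * ∑ S ∈ U.powerset, (S.card : ℝ) * (a ^ S.card * b ^ (U.card - S.card)) =
      U.card * a * (a + b) ^ U.card := by
  rw [Finset.sum_powerset_apply_card (fun j ↦ (j : ℝ) * (a ^ j * b ^ (U.card - j)))]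
  rcases U.card with _ | m
  · simp
  · rw [Finset.sum_range_succ', pow_succ' (a + b), add_pow a b m]
    simp only [nsmul_eq_mul, Nat.cast_zero, zero_mul, mul_zero, add_zero]
    rw [mul_left_comm]
    congr 1
    rw [Finset.mul_sum]
    refine Finset.sum_congr rfl fun j _ ↦ ?_
    have h : ((m + 1 : ℕ) : ℝ) * (m.choose j : ℝ) =
        ((m + 1).choose (j + 1) : ℝ) * ((j + 1 : ℕ) : ℝ) := by
      exact_mod_cast Nat.add_one_mul_choose_eq m j
    rw [Nat.add_sub_add_right, pow_succ]
    linear_combination (-(a ^ j * a * b ^ (m - j))) * h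

lemma erMeasure_real_reachesWithin_le (n : ℕ) {p : ℝ} (h0 : 0 ≤ p) (h1 : p ≤ 1) (N : ℕ) :
    ∀ A U : Finset (Fin n), Disjoint A U → A.card + U.card = N →
    (erMeasure n p).real {ω | ReachesWithin (erGraph n ω) A U} ≤
      (1 - (1 - p) ^ N) ^ U.card := by
  have := isProbabilityMeasure_erMeasure n h0 h1
  have hq0 : 0 ≤ 1 - p := by linarith
  have hq1 : 1 - p ≤ 1 := by linarith
  induction N with
  | zero =>
    intro A U _ hN
    obtain ⟨-, hU⟩ := Nat.add_eq_zero_iff.1 hN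
    rw [hU, pow_zero]
    exact measureReal_le_one
  | succ N ih =>
    intro A U hAU hN
    induction A using Finset.induction_on with
    | empty =>
      have hU : U.Nonempty := Finset.card_pos.1 (by simp at hN; omega)
      simp only [not_reachesWithin_empty_left _ hU, Set.ofPred_false, measureReal_empty]
      exact pow_nonneg (sub_nonneg.2 (pow_le_one₀ hq0 hq1)) _
    | insert a A haA =>
      rw [Finset.disjoint_insert_left] at hAU
      rw [Finset.card_insert_of_notMem haA] at hN
      rw [erMeasure_real_reachesWithin_insert n h0 h1 a A U haA hAU.1]
      calc _ ≤ ∑ S ∈ U.powerset, p ^ S.card *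
            ((1 - p) * (1 - (1 - p) ^ N)) ^ (U.card - S.card) := by
            refine Finset.sum_le_sum fun S hS ↦ ?_
            rw [Finset.mem_powerset] at hS
            have hdisj : Disjoint A S := hAU.2.mono_right hS
            have hle := Finset.card_le_card hS
            have := ih (A ∪ S) (U \ S)
              (Finset.disjoint_union_left.2
                ⟨hAU.2.mono_right Finset.sdiff_subset, Finset.disjoint_sdiff⟩)
              (by rw [Finset.card_union_of_disjoint hdisj, Finset.card_sdiff_of_subset hS]; omega)
            rw [Finset.card_sdiff_of_subset hS] at this
            rw [mul_pow, ← mul_assoc]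
            gcongr
        _ = _ := by
            rw [Finset.sum_pow_mul_eq_add_pow]
            ring

lemma le_erMeasure_real_reachesWithin (n : ℕ) {p : ℝ} (h0 : 0 < p) (h1 : p ≤ 1) (N : ℕ) :
    ∀ A U : Finset (Fin n), Disjoint A U → A.card + U.card = N →
    A.card * (1 - (1 - p) ^ N) ^ U.card ≤
      N * (erMeasure n p).real {ω | ReachesWithin (erGraph n ω) A U} := by
  have := isProbabilityMeasure_erMeasure n h0.le h1
  have hq0 : 0 ≤ 1 - p := by linarith
  have hq1 : 1 - p < 1 := by linarith
  induction N with
  | zero =>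
    intro A U _ hN
    obtain ⟨hA, -⟩ := Nat.add_eq_zero_iff.1 hN
    simp [hA]
  | succ N ih =>
    intro A U hAU hN
    induction A using Finset.induction_on with
    | empty =>
      simp only [Finset.card_empty, Nat.cast_zero, zero_mul]
      positivity
    | insert a A haA =>
      rw [Finset.disjoint_insert_left] at hAU
      rw [Finset.card_insert_of_notMem haA] at hN ⊢
      rcases Nat.eq_zero_or_pos N with rfl | hNpos
      · have hA : A.card = 0 := by omega
        have hU : U = ∅ := Finset.card_eq_zero.1 (by omega)
        simp [hU, hA, reachesWithin_empty_right]
      have hstep : ∑ S ∈ U.powerset, ((A.card : ℝ) + S.card) * (p ^ S.card *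
            ((1 - p) * (1 - (1 - p) ^ N)) ^ (U.card - S.card)) ≤
          N * (erMeasure n p).real {ω | ReachesWithin (erGraph n ω) (insert a A) U} := by
        rw [erMeasure_real_reachesWithin_insert n h0.le h1 a A U haA hAU.1, Finset.mul_sum]
        refine Finset.sum_le_sum fun S hS ↦ ?_
        rw [Finset.mem_powerset] at hS
        have hdisj : Disjoint A S := hAU.2.mono_right hS
        have hle := Finset.card_le_card hS
        have := ih (A ∪ S) (U \ S)
          (Finset.disjoint_union_left.2
            ⟨hAU.2.mono_right Finset.sdiff_subset, Finset.disjoint_sdiff⟩)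
          (by rw [Finset.card_union_of_disjoint hdisj, Finset.card_sdiff_of_subset hS]; omega)
        rw [Finset.card_sdiff_of_subset hS, Finset.card_union_of_disjoint hdisj,
          Nat.cast_add] at this
        have := mul_le_mul_of_nonneg_left this
          (show 0 ≤ p ^ S.card * (1 - p) ^ (U.card - S.card) by positivity)
        rw [mul_pow]
        linarith
      set P := (erMeasure n p).real {ω | ReachesWithin (erGraph n ω) (insert a A) U}
      set s := 1 - (1 - p) ^ (N + 1) with hs
      have hsum : p + (1 - p) * (1 - (1 - p) ^ N) = s := by rw [hs]; ring
      have hspos : 0 < s := sub_pos.2 (pow_lt_one₀ hq0 hq1 (by omega))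
      have hw := sum_powerset_card_mul_pow U p ((1 - p) * (1 - (1 - p) ^ N))
      simp only [add_mul, Finset.sum_add_distrib, ← Finset.mul_sum] at hstep
      rw [Finset.sum_pow_mul_eq_add_pow, hsum] at hstep
      rw [hsum] at hw
      set W := ∑ S ∈ U.powerset, (S.card : ℝ) * (p ^ S.card *
            ((1 - p) * (1 - (1 - p) ^ N)) ^ (U.card - S.card))
      have hbern : s ≤ (N + 1) * p := by
        have := one_add_mul_le_pow (a := -p) (by linarith) (N + 1)
        rw [← sub_eq_add_neg] at this
        push_cast at this
        linarith
      have hNcast : (N : ℝ) = A.card + U.card := by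
        have : N = A.card + U.card := by omega
        exact_mod_cast this
      have hN0 : (0 : ℝ) < N := by exact_mod_cast hNpos
      have hX : 0 ≤ s ^ U.card := by positivity
      have hWlow : U.card * s ^ U.card ≤ (N + 1) * W := by
        refine le_of_mul_le_mul_left ?_ hspos
        have := mul_le_mul_of_nonneg_right hbern
          (show 0 ≤ (U.card : ℝ) * s ^ U.card by positivity)
        nlinarith
      push_cast
      refine le_of_mul_le_mul_left ?_ hN0
      calc (N : ℝ) * ((A.card + 1) * s ^ U.card)
          = (N + 1) * (A.card * s ^ U.card) + U.card * s ^ U.card := by rw [hNcast]; ring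
        _ ≤ (N + 1) * (A.card * s ^ U.card + W) := by linarith
        _ ≤ (N + 1) * (N * P) := by gcongr
        _ = N * ((N + 1) * P) := by ring

lemma erMeasure_real_connected_le {n : ℕ} (hn : 1 ≤ n) {p : ℝ} (h0 : 0 ≤ p) (h1 : p ≤ 1) :
    (erMeasure n p).real {ω | (erGraph n ω).Connected} ≤ (1 - (1 - p) ^ n) ^ (n - 1) := by
  let r : Fin n := ⟨0, hn⟩
  have hcard : (Finset.univ.erase r).card = n - 1 := by simp
  have h := erMeasure_real_reachesWithin_le n h0 h1 n {r} (Finset.univ.erase r) (by simp)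
    (by rw [hcard, Finset.card_singleton]; omega)
  simpa only [hcard, ← connected_iff_reachesWithin] using h

lemma le_erMeasure_real_connected {n : ℕ} (hn : 1 ≤ n) {p : ℝ} (h0 : 0 < p) (h1 : p ≤ 1) :
    (1 - (1 - p) ^ n) ^ (n - 1) ≤
      n * (erMeasure n p).real {ω | (erGraph n ω).Connected} := by
  let r : Fin n := ⟨0, hn⟩
  have hcard : (Finset.univ.erase r).card = n - 1 := by simp
  have h := le_erMeasure_real_reachesWithin n h0 h1 n {r} (Finset.univ.erase r) (by simp)
    (by rw [hcard, Finset.card_singleton]; omega)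
  simpa only [hcard, ← connected_iff_reachesWithin, Finset.card_singleton, Nat.cast_one,
    one_mul] using h

lemma one_sub_div_pow_ge {α : ℝ} {n : ℕ} (hα : 0 ≤ α) (hn : 1 ≤ n) (hαn : α ≤ n) :
    Real.exp (-α) * (1 - α ^ 2 / n) ≤ (1 - α / n) ^ n := by
  have hn0 : (0 : ℝ) < n := by exact_mod_cast hn
  set x := α / n with hx
  have hx0 : 0 ≤ x := by positivity
  have hx1 : x ≤ 1 := (div_le_one hn0).2 hαn
  have hexp : Real.exp (-α) = Real.exp (-x) ^ n := by
    rw [← Real.exp_nat_mul, hx]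
    congr 1
    field_simp
  have hbern : 1 - α ^ 2 / n ≤ (1 - x ^ 2) ^ n := by
    have := one_add_mul_le_pow (a := -x ^ 2) (by nlinarith) n
    rw [← sub_eq_add_neg] at this
    have h : (n : ℝ) * x ^ 2 = α ^ 2 / n := by
      rw [hx]
      field_simp
    linarith
  have hone : Real.exp (-x) * (1 - x ^ 2) ≤ 1 - x := by
    rw [Real.exp_neg, inv_mul_le_iff₀ (Real.exp_pos x)]
    nlinarith [Real.add_one_le_exp x]
  calc Real.exp (-α) * (1 - α ^ 2 / n) ≤ Real.exp (-α) * (1 - x ^ 2) ^ n := by gcongr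
    _ = (Real.exp (-x) * (1 - x ^ 2)) ^ n := by rw [hexp, mul_pow]
    _ ≤ (1 - x) ^ n := by
      have : 0 ≤ 1 - x ^ 2 := by nlinarith
      gcongr

lemma one_sub_one_sub_div_pow_pow_le {α : ℝ} {n : ℕ} (hα : 0 < α) (hn : 1 ≤ n) (hαn : α ≤ n) :
    (1 - (1 - α / n) ^ n) ^ (n - 1) ≤
      Real.exp (α ^ 2 / (1 - Real.exp (-α))) / (1 - Real.exp (-α)) *
        (1 - Real.exp (-α)) ^ n := by
  have hn0 : (0 : ℝ) < n := by exact_mod_cast hn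
  have hexp1 : Real.exp (-α) < 1 := Real.exp_lt_one_iff.2 (by linarith)
  set β := 1 - Real.exp (-α) with hβ
  have hβ0 : 0 < β := by linarith
  have hx1 : α / n ≤ 1 := (div_le_one hn0).2 hαn
  have hs0 : 0 ≤ 1 - (1 - α / n) ^ n :=
    sub_nonneg.2 (pow_le_one₀ (by linarith) (by linarith [div_pos hα hn0]))
  have hbase : 1 - (1 - α / n) ^ n ≤ β * Real.exp (α ^ 2 / β / n) := by
    have h1 := one_sub_div_pow_ge hα.le hn hαn
    have h2 := Real.add_one_le_exp (α ^ 2 / β / n)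
    have h3 : β * (α ^ 2 / β / n + 1) = α ^ 2 / n + β := by field_simp
    have h4 : Real.exp (-α) * (α ^ 2 / n) ≤ α ^ 2 / n :=
      mul_le_of_le_one_left (by positivity) hexp1.le
    have h5 := mul_le_mul_of_nonneg_left h2 hβ0.le
    linarith
  have hpow : β ^ n = β * β ^ (n - 1) := by rw [← pow_succ', Nat.sub_add_cancel hn]
  calc (1 - (1 - α / n) ^ n) ^ (n - 1) ≤ (β * Real.exp (α ^ 2 / β / n)) ^ (n - 1) := by gcongr
    _ = β ^ (n - 1) * Real.exp (α ^ 2 / β / n) ^ (n - 1) := mul_pow _ _ _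
    _ ≤ β ^ (n - 1) * Real.exp (α ^ 2 / β / n) ^ n := by
      gcongr
      · exact Real.one_le_exp (by positivity)
      · omega
    _ = β ^ (n - 1) * Real.exp (α ^ 2 / β) := by
      rw [← Real.exp_nat_mul]
      congr 2
      field_simp
    _ = _ := by rw [hpow]; field_simp

theorem connected_prob_polylog (α : ℝ) (hα : 0 ≤ α) :
    ∃ (C : ℝ) (n₀ : ℕ), ∀ n : ℕ, n₀ ≤ n →
      (n : ℝ) ^ (-C) * (1 - Real.exp (-α)) ^ n ≤
        (erMeasure n (α / n) {ω | (erGraph n ω).Connected}).toReal ∧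
      (erMeasure n (α / n) {ω | (erGraph n ω).Connected}).toReal ≤
        (n : ℝ) ^ (C : ℝ) * (1 - Real.exp (-α)) ^ n := by
  simp only [← measureReal_def]
  rcases hα.eq_or_lt with rfl | hα
  · refine ⟨1, 2, fun n hn ↦ ?_⟩
    have h := erMeasure_real_connected_le (n := n) (by omega) le_rfl zero_le_one
    simpa [show n ≠ 0 by omega, show n - 1 ≠ 0 by omega] using h
  set D := Real.exp (α ^ 2 / (1 - Real.exp (-α))) / (1 - Real.exp (-α))
  refine ⟨1, max 1 (max ⌈α⌉₊ ⌈D⌉₊), fun n hn ↦ ?_⟩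
  simp only [max_le_iff, Nat.ceil_le] at hn
  obtain ⟨hn1, hαn, hDn⟩ := hn
  have hn0 : (0 : ℝ) < n := by exact_mod_cast hn1
  have hexp1 : Real.exp (-α) < 1 := Real.exp_lt_one_iff.2 (by linarith)
  have hβ0 : 0 ≤ 1 - Real.exp (-α) := by linarith
  have hβ1 : 1 - Real.exp (-α) ≤ 1 := by linarith [Real.exp_pos (-α)]
  have hp0 : 0 < α / n := div_pos hα hn0
  have hp1 : α / n ≤ 1 := (div_le_one hn0).2 hαn
  rw [Real.rpow_neg_one, Real.rpow_one]
  constructor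
  · rw [inv_mul_le_iff₀ hn0]
    calc (1 - Real.exp (-α)) ^ n ≤ (1 - Real.exp (-α)) ^ (n - 1) :=
          pow_le_pow_of_le_one hβ0 hβ1 (by omega)
      _ ≤ (1 - (1 - α / n) ^ n) ^ (n - 1) := by
          gcongr
          exact Real.one_sub_div_pow_le_exp_neg hαn
      _ ≤ _ := le_erMeasure_real_connected hn1 hp0 hp1
  · calc _ ≤ _ := erMeasure_real_connected_le hn1 hp0.le hp1
      _ ≤ D * (1 - Real.exp (-α)) ^ n := one_sub_one_sub_div_pow_pow_le hα hn1 hαn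
      _ ≤ _ := by gcongr
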